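/- arXiv:2312.16786 — 2 statements merged into one kernel-verified Lean document; each statement's English description precedes it below -/
import Mathlib

section
/- Let n ≥ 1, let I ⊆ [n-1] be nonempty, and set J = {n−i : i ∈ I}. Then a(I;n) = a(J;n), i.e., the number of parking functions of length n with ascent set exactly I equals the number of parking functions of length n with ascent set exactly J. -/
open scoped Classical

/-- `f : Fin n → Fin n` (entries 0-indexed, value `v` encodes preference `v+1`) is a
parking function: some rearrangement `f ∘ σ` is nondecreasing and its `i`-th entry
(0-indexed) is at most `i`. -/
def IsPF {n : ℕ} (f : Fin n → Fin n) : Prop :=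
  ∃ σ : Equiv.Perm (Fin n), Monotone (f ∘ σ) ∧ ∀ i : Fin n, (f (σ i) : ℕ) ≤ (i : ℕ)

/-- The (1-indexed) ascent set of a tuple `a_1, …, a_k`: the indices `i ∈ [k-1]`
with `a_i < a_{i+1}`.  (Here `a_i = f ⟨i-1, _⟩`.) -/
def ascSet {k : ℕ} {α : Type*} [LT α] (f : Fin k → α) : Set ℕ :=
  {i | ∃ h : 1 ≤ i ∧ i < k, f ⟨i - 1, (Nat.sub_le i 1).trans_lt h.2⟩ < f ⟨i, h.2⟩}

/-- The start of the block containing position `p` when the positions are cut at `I`. -/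
def blockStart (I : Finset ℕ) (p : ℕ) : ℕ := (I.filter (· ≤ p)).sup id

theorem blockStart_le (I : Finset ℕ) (p : ℕ) : blockStart I p ≤ p :=
  Finset.sup_le fun _ hi => (Finset.mem_filter.1 hi).2

theorem le_blockStart {I : Finset ℕ} {p i : ℕ} (hi : i ∈ I) (hp : i ≤ p) :
    i ≤ blockStart I p :=
  Finset.le_sup (f := id) (Finset.mem_filter.2 ⟨hi, hp⟩)

theorem blockStart_eq_zero_or_mem (I : Finset ℕ) (p : ℕ) :
    blockStart I p = 0 ∨ blockStart I p ∈ I := by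
  rcases (I.filter (· ≤ p)).eq_empty_or_nonempty with h | h
  · left
    simp [blockStart, h]
  · right
    obtain ⟨i, hi, h⟩ := Finset.exists_mem_eq_sup _ h id
    rw [blockStart, h]
    exact (Finset.mem_filter.1 hi).1

theorem blockStart_eq {I : Finset ℕ} {p l : ℕ} (hl : l ≤ p) (hmem : l = 0 ∨ l ∈ I)
    (hmax : ∀ i ∈ I, i ≤ p → i ≤ l) : blockStart I p = l := by
  refine le_antisymm (Finset.sup_le fun i hi => ?_) ?_
  · exact hmax i (Finset.mem_filter.1 hi).1 (Finset.mem_filter.1 hi).2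
  · rcases hmem with rfl | h
    · exact Nat.zero_le _
    · exact le_blockStart h hl

theorem blockStart_pred {I : Finset ℕ} {p : ℕ} (hp : 1 ≤ p) (h : p ∉ I) :
    blockStart I (p - 1) = blockStart I p := by
  symm
  refine blockStart_eq ((blockStart_le _ _).trans (Nat.sub_le _ _))
    (blockStart_eq_zero_or_mem _ _) fun i hi hip => le_blockStart hi ?_
  have : i ≠ p := fun e => h (e ▸ hi)
  omega

/-- The two sets of cuts are exchanged by `i ↦ n - i`. -/
def CutsReversed (n : ℕ) (I J : Finset ℕ) : Prop :=
  (∀ i ∈ I, 1 ≤ i ∧ i < n ∧ n - i ∈ J) ∧ (∀ j ∈ J, 1 ≤ j ∧ j < n ∧ n - j ∈ I)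

theorem CutsReversed.symm {n : ℕ} {I J : Finset ℕ} (h : CutsReversed n I J) :
    CutsReversed n J I := ⟨h.2, h.1⟩

theorem cutsReversed_image {n : ℕ} {I : Finset ℕ} (hI : I ⊆ Finset.Icc 1 (n - 1)) :
    CutsReversed n I (I.image (fun i => n - i)) := by
  constructor
  · intro i hi
    have := Finset.mem_Icc.1 (hI hi)
    exact ⟨by omega, by omega, Finset.mem_image_of_mem _ hi⟩
  · intro j hj
    obtain ⟨i, hi, rfl⟩ := Finset.mem_image.1 hj
    have := Finset.mem_Icc.1 (hI hi)
    refine ⟨by omega, by omega, ?_⟩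
    rwa [show n - (n - i) = i by omega]

/-- Where position `p` goes when the order of the blocks cut out by `I` is reversed, each block
being translated as a whole. -/
def blockShift (n : ℕ) (I J : Finset ℕ) (p : ℕ) : ℕ :=
  blockStart J (n - 1 - p) + p - blockStart I p

theorem blockShift_lt {n : ℕ} (I J : Finset ℕ) {p : ℕ} (hp : p < n) :
    blockShift n I J p < n := by
  have := blockStart_le J (n - 1 - p)
  unfold blockShift
  omega

theorem blockStart_blockShift {n : ℕ} {I J : Finset ℕ} (h : CutsReversed n I J) {p : ℕ}
    (hp : p < n) : blockStart J (blockShift n I J p) = blockStart J (n - 1 - p) := by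
  have h1 := blockStart_le J (n - 1 - p)
  have h2 := blockStart_le I p
  refine blockStart_eq (by unfold blockShift; omega) (blockStart_eq_zero_or_mem _ _) ?_
  intro j hj hjq
  by_contra hlt
  obtain ⟨hj1, hjn, hjI⟩ := h.2 j hj
  have h3 : ¬ j ≤ n - 1 - p := fun hle => hlt (le_blockStart hj hle)
  have h4 := le_blockStart (p := p) hjI (by omega)
  unfold blockShift at hjq
  omega

theorem blockStart_compl_blockShift {n : ℕ} {I J : Finset ℕ} (h : CutsReversed n I J) {p : ℕ}
    (hp : p < n) : blockStart I (n - 1 - blockShift n I J p) = blockStart I p := by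
  have h1 := blockStart_le J (n - 1 - p)
  have h2 := blockStart_le I p
  refine blockStart_eq (by unfold blockShift; omega) (blockStart_eq_zero_or_mem _ _) ?_
  intro i hi hiq
  by_contra hlt
  obtain ⟨hi1, hin, hiJ⟩ := h.1 i hi
  have h3 : ¬ i ≤ p := fun hle => hlt (le_blockStart hi hle)
  have h4 := le_blockStart (p := n - 1 - p) hiJ (by omega)
  unfold blockShift at hiq
  omega

theorem blockShift_blockShift {n : ℕ} {I J : Finset ℕ} (h : CutsReversed n I J) {p : ℕ}
    (hp : p < n) : blockShift n J I (blockShift n I J p) = p := by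
  have h2 := blockStart_le I p
  rw [blockShift, blockStart_blockShift h hp, blockStart_compl_blockShift h hp, blockShift]
  omega

theorem blockShift_pred {n : ℕ} {I J : Finset ℕ} (h : CutsReversed n I J) {p : ℕ}
    (hp1 : 1 ≤ p) (hp : p < n) (hpI : p ∉ I) :
    blockShift n I J (p - 1) + 1 = blockShift n I J p := by
  have hnp : n - p ∉ J := fun hJ => hpI <| by
    have := (h.2 _ hJ).2.2
    rwa [show n - (n - p) = p by omega] at this
  have h1 := blockStart_pred (p := n - p) (by omega) hnp
  have h2 := blockStart_le I (p - 1)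
  rw [blockShift, blockShift, ← blockStart_pred hp1 hpI, show n - 1 - (p - 1) = n - p by omega,
    ← h1, show n - p - 1 = n - 1 - p by omega]
  omega

theorem blockShift_notMem {n : ℕ} {I J : Finset ℕ} (h : CutsReversed n I J) {p : ℕ}
    (hp1 : 1 ≤ p) (hp : p < n) (hpI : p ∉ I) : blockShift n I J p ∉ J := by
  intro hJ
  have h1 := le_blockStart hJ le_rfl
  rw [blockStart_blockShift h hp] at h1
  have h2 := blockStart_le I p
  have h3 : blockStart I p ≠ p := fun e => by
    rcases blockStart_eq_zero_or_mem I p with h0 | h0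
    · omega
    · exact hpI (e ▸ h0)
  unfold blockShift at h1
  omega

/-- `blockShift` as a permutation of the positions. -/
def blockPerm {n : ℕ} {I J : Finset ℕ} (h : CutsReversed n I J) : Equiv.Perm (Fin n) where
  toFun p := ⟨blockShift n I J p, blockShift_lt I J p.2⟩
  invFun p := ⟨blockShift n J I p, blockShift_lt J I p.2⟩
  left_inv p := Fin.ext (blockShift_blockShift h p.2)
  right_inv p := Fin.ext (blockShift_blockShift h.symm p.2)

theorem IsPF.comp_perm {n : ℕ} {f : Fin n → Fin n} (hf : IsPF f) (e : Equiv.Perm (Fin n)) :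
    IsPF (f ∘ e) := by
  obtain ⟨σ, hm, hle⟩ := hf
  refine ⟨σ.trans e.symm, ?_, fun i => ?_⟩
  · convert hm using 1
    ext i
    simp
  · simpa using hle i

theorem ascSet_comp_blockPerm_subset {n : ℕ} {α : Type*} [LT α] {I J : Finset ℕ}
    (h : CutsReversed n I J) {f : Fin n → α} (hf : ascSet f ⊆ ↑J) :
    ascSet (f ∘ blockPerm h) ⊆ ↑I := by
  rintro p ⟨⟨hp1, hp⟩, hlt⟩
  by_contra hpI
  have hpI : p ∉ I := hpI
  have hpred := blockShift_pred h hp1 hp hpI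
  refine blockShift_notMem h hp1 hp hpI (hf ⟨⟨by omega, blockShift_lt I J hp⟩, ?_⟩)
  have hidx : (⟨blockShift n I J p - 1, by have := blockShift_lt I J hp; omega⟩ : Fin n)
      = blockPerm h ⟨p - 1, by omega⟩ := Fin.ext <| by
    change blockShift n I J p - 1 = blockShift n I J (p - 1)
    omega
  rw [hidx]
  exact hlt

theorem card_ascSet_subset_eq {n : ℕ} {I J : Finset ℕ} (h : CutsReversed n I J) :
    (Finset.univ.filter (fun f : Fin n → Fin n => IsPF f ∧ ascSet f ⊆ ↑I)).card
      = (Finset.univ.filter (fun f : Fin n → Fin n => IsPF f ∧ ascSet f ⊆ ↑J)).card := by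
  refine Finset.card_bij' (fun f _ => f ∘ blockPerm h.symm) (fun f _ => f ∘ blockPerm h)
    ?_ ?_ ?_ ?_
  · intro f hf
    obtain ⟨h1, h2⟩ := (Finset.mem_filter.1 hf).2
    exact Finset.mem_filter.2
      ⟨Finset.mem_univ _, h1.comp_perm _, ascSet_comp_blockPerm_subset h.symm h2⟩
  · intro f hf
    obtain ⟨h1, h2⟩ := (Finset.mem_filter.1 hf).2
    exact Finset.mem_filter.2
      ⟨Finset.mem_univ _, h1.comp_perm _, ascSet_comp_blockPerm_subset h h2⟩
  · intro f _
    ext p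
    exact congrArg (fun x => (f x : ℕ)) ((blockPerm h).left_inv p)
  · intro f _
    ext p
    exact congrArg (fun x => (f x : ℕ)) ((blockPerm h).right_inv p)

theorem card_ascSet_subset_eq_sum (n : ℕ) (I : Finset ℕ) :
    (Finset.univ.filter (fun f : Fin n → Fin n => IsPF f ∧ ascSet f ⊆ ↑I)).card
      = ∑ K ∈ I.powerset,
        (Finset.univ.filter (fun f : Fin n → Fin n => IsPF f ∧ ascSet f = ↑K)).card := by
  have hcoe : ∀ f : Fin n → Fin n, ascSet f ⊆ ↑I →
      ((I.filter (· ∈ ascSet f) : Finset ℕ) : Set ℕ) = ascSet f := fun f hf => by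
    ext i
    simpa using fun hi => hf hi
  rw [Finset.card_eq_sum_card_fiberwise (f := fun f => I.filter (· ∈ ascSet f))
    (t := I.powerset) fun f _ => Finset.mem_powerset.2 (Finset.filter_subset _ _)]
  refine Finset.sum_congr rfl fun K hK => congrArg Finset.card ?_
  ext f
  simp only [Finset.mem_filter, Finset.mem_univ, true_and]
  constructor
  · rintro ⟨⟨h1, h2⟩, rfl⟩
    exact ⟨h1, (hcoe f h2).symm⟩
  · rintro ⟨h1, h2⟩
    have h3 : ascSet f ⊆ ↑I := h2 ▸ Finset.coe_subset.2 (Finset.mem_powerset.1 hK)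
    exact ⟨⟨h1, h3⟩, Finset.coe_injective ((hcoe f h3).trans h2)⟩

theorem card_ascSet_eq_card_image (n : ℕ) (I : Finset ℕ) (hI : I ⊆ Finset.Icc 1 (n - 1)) :
    (Finset.univ.filter (fun f : Fin n → Fin n => IsPF f ∧ ascSet f = ↑I)).card
      = (Finset.univ.filter (fun f : Fin n → Fin n =>
          IsPF f ∧ ascSet f = ↑(I.image (fun i => n - i)))).card := by
  induction I using Finset.strongInduction with
  | H I ih =>
    have hinj : Set.InjOn (fun i => n - i) (I : Set ℕ) := fun i hi j hj hij => by
      have h1 := Finset.mem_Icc.1 (hI hi)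
      have h2 := Finset.mem_Icc.1 (hI hj)
      have h3 : n - i = n - j := hij
      omega
    have hinj' : Set.InjOn (fun K : Finset ℕ => K.image (fun i => n - i))
        (I.powerset : Set (Finset ℕ)) := fun K hK L hL hKL => by
      have hK' := Finset.mem_powerset.1 (Finset.mem_coe.1 hK)
      have hL' := Finset.mem_powerset.1 (Finset.mem_coe.1 hL)
      have hKL' : (fun i => n - i) '' (K : Set ℕ) = (fun i => n - i) '' (L : Set ℕ) := by
        simpa using congrArg (fun S : Finset ℕ => (S : Set ℕ)) hKL
      exact Finset.coe_injective <|
        (hinj.image_eq_image_iff (Finset.coe_subset.2 hK') (Finset.coe_subset.2 hL')).1 hKL'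
    have key := card_ascSet_subset_eq (cutsReversed_image hI)
    rw [card_ascSet_subset_eq_sum, card_ascSet_subset_eq_sum, Finset.powerset_image,
      Finset.sum_image hinj', ← Finset.add_sum_erase _ _ (Finset.mem_powerset_self I),
      ← Finset.add_sum_erase _ _ (Finset.mem_powerset_self I)] at key
    have hrest := Finset.sum_congr (rfl : I.powerset.erase I = I.powerset.erase I) fun K hK =>
      have hKI := Finset.mem_powerset.1 (Finset.mem_of_mem_erase hK)
      ih K (Finset.ssubset_iff_subset_ne.2 ⟨hKI, Finset.ne_of_mem_erase hK⟩) (hKI.trans hI)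
    rw [hrest] at key
    exact Nat.add_right_cancel key

/-- For nonempty `I ⊆ [n-1]` and `J = {n - i : i ∈ I}`, the number of parking functions
of length `n` with ascent set exactly `I` equals the number with ascent set exactly `J`. -/
theorem stmt2 (n : ℕ) (hn : 1 ≤ n) (I : Finset ℕ) (hne : I.Nonempty)
    (hI : I ⊆ Finset.Icc 1 (n - 1)) :
    (Finset.univ.filter (fun f : Fin n → Fin n => IsPF f ∧ ascSet f = ↑I)).card
      = (Finset.univ.filter (fun f : Fin n → Fin n =>
          IsPF f ∧ ascSet f = ↑(I.image (fun i => n - i)))).card :=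
  card_ascSet_eq_card_image n I hI
end

section
/- For every n ≥ 1, the number of peakless-tieless parking functions of length n is the n-th Catalan number: |PTPF_n| = C_n = (1/(n+1))·binomial(2n,n). -/
open scoped Classical

/-- The (1-indexed) peak set of a tuple `a_1, …, a_k`: the indices `i` with
`2 ≤ i ≤ k-1` and `a_{i-1} < a_i > a_{i+1}`.  (Here `a_i = f ⟨i-1, _⟩`.) -/
def peakSet {k : ℕ} {α : Type*} [LT α] (f : Fin k → α) : Set ℕ :=
  {i | ∃ h : 2 ≤ i ∧ i < k,
    f ⟨i - 2, (Nat.sub_le i 2).trans_lt h.2⟩ < f ⟨i - 1, (Nat.sub_le i 1).trans_lt h.2⟩ ∧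
    f ⟨i, h.2⟩ < f ⟨i - 1, (Nat.sub_le i 1).trans_lt h.2⟩}

/-- The (1-indexed) tie set of a tuple `a_1, …, a_k`: the indices `i ∈ [k-1]`
with `a_i = a_{i+1}`.  (Here `a_i = f ⟨i-1, _⟩`.) -/
def tieSet {k : ℕ} {α : Type*} (f : Fin k → α) : Set ℕ :=
  {i | ∃ h : 1 ≤ i ∧ i < k, f ⟨i - 1, (Nat.sub_le i 1).trans_lt h.2⟩ = f ⟨i, h.2⟩}

section

open Finset DyckStep

/-- Sets of up-step positions of Dyck paths with `n` up-steps. -/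
def IsBallotSet (n : ℕ) (S : Finset ℕ) : Prop :=
  S ⊆ range (2 * n) ∧ #S = n ∧ ∀ i ≤ 2 * n, i ≤ 2 * #{s ∈ S | s < i}

lemma count_take_eq_card (l : List DyckStep) (a : DyckStep) (i : ℕ) :
    (l.take i).count a = #{j ∈ range i | l[j]? = some a} := by
  induction i with
  | zero => simp
  | succ i ih =>
    rw [List.take_add_one, List.count_append, ih, range_add_one, filter_insert]
    rcases h : l[i]? with _ | b
    · simp
    · by_cases hb : b = a <;> simp [hb]

lemma count_U_add_count_D (l : List DyckStep) : l.count U + l.count D = l.length := by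
  induction l with
  | nil => rfl
  | cons a l ih => cases a <;> simp <;> omega

lemma getElem?_eq_some_D_iff {l : List DyckStep} {j : ℕ} (hj : j < l.length) :
    l[j]? = some D ↔ l[j]? ≠ some U := by
  rw [List.getElem?_eq_getElem hj]
  cases l[j] <;> simp

/-- Dyck words correspond to their sets of up-step positions. -/
lemma card_isBallotSet (n : ℕ) : Nat.card {S // IsBallotSet n S} = catalan n := by
  rw [← DyckWord.card_dyckWord_semilength_eq_catalan, ← Nat.card_eq_fintype_card]
  symm
  have hlen (p : DyckWord) (hp : p.semilength = n) : p.toList.length = 2 * n := by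
    rw [← DyckWord.two_mul_semilength_eq_length, hp]
  have hfilter (p : DyckWord) (i : ℕ) (hi : i ≤ 2 * n) :
      ({s ∈ range (2 * n) | p.toList[s]? = some U} : Finset ℕ).filter (· < i) =
        {s ∈ range i | p.toList[s]? = some U} := by
    ext s; simp; grind
  refine Nat.card_eq_of_bijective (fun p : {p : DyckWord // p.semilength = n} =>
    (⟨{j ∈ range (2 * n) | p.1.toList[j]? = some U}, filter_subset _ _, ?_, ?_⟩ :
      {S // IsBallotSet n S})) ⟨?_, ?_⟩
  · obtain ⟨p, hp⟩ := p
    rw [← count_take_eq_card, ← hlen p hp, List.take_length]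
    exact hp
  · intro i hi
    obtain ⟨p, hp⟩ := p
    rw [hfilter p i hi, ← count_take_eq_card]
    have h1 := p.count_D_le_count_U i
    have h2 := count_U_add_count_D (p.toList.take i)
    rw [List.length_take, hlen p hp] at h2
    omega
  · rintro ⟨p, hp⟩ ⟨q, hq⟩ h
    have h' := Finset.ext_iff.1 (Subtype.ext_iff.1 h)
    simp only [mem_filter, mem_range] at h'
    refine Subtype.ext (DyckWord.ext (List.ext_getElem? fun j => ?_))
    by_cases hj : j < 2 * n
    · have hpj := getElem?_eq_some_D_iff (l := p.toList) (j := j) (by rw [hlen p hp]; exact hj)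
      have hqj := getElem?_eq_some_D_iff (l := q.toList) (j := j) (by rw [hlen q hq]; exact hj)
      have := h' j
      by_cases hU : p.toList[j]? = some U
      · rw [hU, (this.1 ⟨hj, hU⟩).2]
      · rw [hpj.2 hU, hqj.2 fun hq => hU (this.2 ⟨hj, hq⟩).2]
    · rw [List.getElem?_eq_none (by rw [hlen p hp]; omega),
        List.getElem?_eq_none (by rw [hlen q hq]; omega)]
  · rintro ⟨S, hS, hcard, hbal⟩
    set l : List DyckStep := (List.range (2 * n)).map fun j => if j ∈ S then U else D with hl
    have hll : l.length = 2 * n := by simp [hl]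
    have hU (j : ℕ) : l[j]? = some U ↔ j ∈ S := by
      have := @hS j
      simp only [hl, List.getElem?_map, mem_range] at this ⊢
      by_cases hj : j < 2 * n
      · simp [List.getElem?_range hj]
      · rw [List.getElem?_eq_none (by simpa using hj)]
        simpa using fun h => hj (this h)
    have hcount (i : ℕ) : (l.take i).count U = #{s ∈ S | s < i} := by
      rw [count_take_eq_card]
      congr 1
      ext j; simp [hU, and_comm]
    have hlU : l.count U = n := by
      rw [← List.take_length (l := l), hcount, hll,
        filter_true_of_mem fun s hs => mem_range.1 (hS hs), hcard]
    have hsum := count_U_add_count_D l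
    refine ⟨⟨⟨l, by omega, fun i => ?_⟩, hlU⟩, ?_⟩
    · have h2 := count_U_add_count_D (l.take i)
      rw [List.length_take, hll] at h2
      rcases le_total i (2 * n) with hi | hi
      · have := hbal i hi
        rw [← hcount] at this
        omega
      · rw [List.take_of_length_le (by omega)]
        omega
    · refine Subtype.ext ?_
      ext j
      simpa [hU] using @hS j

/-- A tuple is a parking function iff at least `k` of its entries are less than `k`. -/
lemma isPF_iff {n : ℕ} (f : Fin n → Fin n) :
    IsPF f ↔ ∀ k ≤ n, k ≤ #{i | (f i : ℕ) < k} := by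
  constructor
  · rintro ⟨σ, -, hσ⟩ k hk
    calc k = #{i : Fin n | (i : ℕ) < k} := by simp [Fin.card_filter_val_lt, hk]
      _ = #(({i : Fin n | (i : ℕ) < k} : Finset (Fin n)).map σ.toEmbedding) := by
        rw [card_map]
      _ ≤ _ := card_le_card fun j => by
        simp only [mem_map, mem_filter, mem_univ, true_and]
        rintro ⟨i, hi, rfl⟩
        exact (hσ i).trans_lt hi
  · intro h
    refine ⟨Tuple.sort f, Tuple.monotone_sort f, fun i => ?_⟩
    by_contra! hi
    have h1 : #{j | (f j : ℕ) < i + 1} ≤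
        #((univ.filter (· < i)).map (Tuple.sort f).toEmbedding) := card_le_card fun j => by
      simp only [mem_map, mem_filter, mem_univ, true_and]
      intro hj
      refine ⟨(Tuple.sort f).symm j, ?_, by simp⟩
      by_contra! hle
      have := Tuple.monotone_sort f hle
      simp only [Function.comp_apply, Equiv.apply_symm_apply, Fin.le_def] at this
      omega
    rw [card_map] at h1
    have h2 : #(univ.filter (· < i)) = (i : ℕ) := by
      rw [← Fin.card_Iio i]
      congr 1
      ext; simp
    have := h (i + 1) i.2
    omega

/-- Strictly increasing integer tuples with at least `k` entries of absolute value less than `k`. -/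
def IsSignedPF {n : ℕ} (t : Fin n → ℤ) : Prop :=
  StrictMono t ∧ ∀ k ≤ n, k ≤ #{i | (t i).natAbs < k}

lemma exists_eq_zero_of_count {n : ℕ} (hn : 1 ≤ n) {g : Fin n → ℕ}
    (h : ∀ k ≤ n, k ≤ #{i | g i < k}) : ∃ p, g p = 0 := by
  obtain ⟨p, hp⟩ := card_pos.1 (h 1 hn)
  exact ⟨p, by simpa using hp⟩

lemma forall_lt_of_count {n : ℕ} {g : Fin n → ℕ}
    (h : ∀ k ≤ n, k ≤ #{i | g i < k}) (i : Fin n) : g i < n := by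
  have h1 : #{i | g i < n} = #(univ : Finset (Fin n)) :=
    le_antisymm (card_le_univ _) (by simpa using h n le_rfl)
  have h2 := filter_card_eq h1
  exact h2 i (mem_univ i)

/-- The zigzag enumeration `0, -1, 1, -2, 2, …` of the integers orders them by absolute value. -/
lemma intEquivNat_lt_iff (z : ℤ) (k : ℕ) (hk : 1 ≤ k) :
    Equiv.intEquivNat z < 2 * k - 1 ↔ z.natAbs < k := by
  rcases z with m | m
  · have : Equiv.intEquivNat (Int.ofNat m) = 2 * m := rfl
    rw [this]
    simp
    omega
  · have : Equiv.intEquivNat (Int.negSucc m) = 2 * m + 1 := rfl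
    rw [this]
    simp
    omega

lemma injective_intEquivNat_strictMono {n : ℕ} {t : Fin n → ℤ} (ht : StrictMono t) :
    Function.Injective fun j => Equiv.intEquivNat (t j) :=
  Equiv.intEquivNat.injective.comp ht.injective

lemma card_filter_image_intEquivNat {n : ℕ} {t : Fin n → ℤ} (ht : StrictMono t) (i : ℕ) :
    #{s ∈ univ.image (fun j => Equiv.intEquivNat (t j)) | s < i} =
      #{j | Equiv.intEquivNat (t j) < i} := by
  rw [filter_image, card_image_of_injective _ (injective_intEquivNat_strictMono ht)]

lemma isBallotSet_image_iff {n : ℕ} (hn : 1 ≤ n) {t : Fin n → ℤ} (ht : StrictMono t) :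
    IsBallotSet n (univ.image fun j => Equiv.intEquivNat (t j)) ↔ IsSignedPF t := by
  simp only [IsBallotSet, IsSignedPF, card_filter_image_intEquivNat ht, ht, true_and]
  constructor
  · rintro ⟨-, -, h⟩ k hk
    rcases Nat.eq_zero_or_pos k with rfl | hk0
    · simp
    have := h (2 * k - 1) (by omega)
    simp only [intEquivNat_lt_iff _ k hk0] at this
    omega
  · intro h
    refine ⟨fun s hs => ?_, ?_, fun i hi => ?_⟩
    · obtain ⟨j, -, rfl⟩ := mem_image.1 hs
      have := (intEquivNat_lt_iff (t j) n hn).2 (forall_lt_of_count h j)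
      exact mem_range.2 (by omega)
    · rw [card_image_of_injective _ (injective_intEquivNat_strictMono ht), card_fin]
    · rcases Nat.eq_zero_or_pos i with rfl | hi0
      · simp
      have h1 := h ((i + 1) / 2) (by omega)
      have h2 : #{j | (t j).natAbs < (i + 1) / 2} ≤ #{j | Equiv.intEquivNat (t j) < i} := by
        refine card_le_card fun j => ?_
        simp only [mem_filter, mem_univ, true_and, ← intEquivNat_lt_iff (t j) ((i + 1) / 2)
          (by omega)]
        omega
      omega

lemma card_isSignedPF {n : ℕ} (hn : 1 ≤ n) :
    Nat.card {t : Fin n → ℤ // IsSignedPF t} = Nat.card {S // IsBallotSet n S} := by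
  refine Nat.card_eq_of_bijective (fun t : {t : Fin n → ℤ // IsSignedPF t} =>
    (⟨_, (isBallotSet_image_iff hn t.2.1).2 t.2⟩ : {S // IsBallotSet n S})) ⟨?_, ?_⟩
  · rintro ⟨t, ht⟩ ⟨u, hu⟩ h
    refine Subtype.ext ((ht.1.range_inj hu.1).1 ?_)
    have h' := congrArg (fun S : Finset ℕ => (S : Set ℕ)) (Subtype.ext_iff.1 h)
    simp only [coe_image, coe_univ, Set.image_univ] at h'
    rw [← Function.comp_def, ← Function.comp_def, Set.range_comp, Set.range_comp] at h'
    exact Equiv.intEquivNat.injective.image_injective h'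
  · rintro ⟨S, hS⟩
    set T := S.map Equiv.intEquivNat.symm.toEmbedding with hT
    have hcard : #T = n := by rw [card_map, hS.2.1]
    have ht : StrictMono (T.orderEmbOfFin hcard) := (T.orderEmbOfFin hcard).strictMono
    have himage : univ.image (fun j => Equiv.intEquivNat (T.orderEmbOfFin hcard j)) = S := by
      have := T.image_orderEmbOfFin_univ hcard
      rw [← Function.comp_def, ← image_image, this, hT]
      ext; simp [← Equiv.eq_symm_apply]
    exact ⟨⟨_, (isBallotSet_image_iff hn ht).1 (himage ▸ hS)⟩, Subtype.ext himage⟩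

lemma peakSet_eq_empty_iff {n : ℕ} {α : Type*} [LT α] (f : Fin n → α) :
    peakSet f = ∅ ↔ ∀ i (h : i + 2 < n),
      f ⟨i, by omega⟩ < f ⟨i + 1, by omega⟩ → ¬ f ⟨i + 2, h⟩ < f ⟨i + 1, by omega⟩ := by
  rw [Set.eq_empty_iff_forall_notMem]
  constructor
  · exact fun H i h h1 h2 => H (i + 2) ⟨⟨by omega, h⟩, h1, h2⟩
  · rintro H i ⟨⟨h2, hi⟩, h⟩
    obtain ⟨i, rfl⟩ := Nat.exists_eq_add_of_le' h2
    exact H i hi h.1 h.2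

lemma tieSet_eq_empty_iff {n : ℕ} {α : Type*} (f : Fin n → α) :
    tieSet f = ∅ ↔ ∀ i (h : i + 1 < n), f ⟨i, by omega⟩ ≠ f ⟨i + 1, h⟩ := by
  rw [Set.eq_empty_iff_forall_notMem]
  constructor
  · exact fun H i h h1 => H (i + 1) ⟨⟨by omega, h⟩, h1⟩
  · rintro H i ⟨⟨h1, hi⟩, h⟩
    obtain ⟨i, rfl⟩ := Nat.exists_eq_add_of_le' h1
    exact H i hi h

/-- Negating the entries of a peakless, tieless tuple before its zero makes it increasing. -/
lemma strictMono_signed {n : ℕ} {f : Fin n → Fin n} (hpeak : peakSet f = ∅) (htie : tieSet f = ∅)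
    {p : Fin n} (hp : (f p : ℕ) = 0) :
    StrictMono fun i => if i < p then -((f i : ℕ) : ℤ) else (f i : ℕ) := by
  rw [peakSet_eq_empty_iff] at hpeak
  rw [tieSet_eq_empty_iff] at htie
  simp only [ne_eq, Fin.ext_iff, Fin.lt_def] at hpeak htie
  have hup (i : ℕ) (hi : i + 1 < n) (hlt : (f ⟨i, by omega⟩ : ℕ) < f ⟨i + 1, hi⟩) (j : ℕ)
      (hij : i ≤ j) : ∀ hj : j + 1 < n, (f ⟨j, by omega⟩ : ℕ) < f ⟨j + 1, hj⟩ := by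
    induction j, hij using Nat.le_induction with
    | base => exact fun _ => hlt
    | succ j _ ih =>
      intro hj
      have := hpeak j hj (ih (by omega))
      have := htie (j + 1) hj
      grind
  obtain ⟨p, hpn⟩ := p
  obtain ⟨n, rfl⟩ : ∃ m, n = m + 1 := ⟨n - 1, by omega⟩
  refine Fin.strictMono_iff_lt_succ.2 fun ⟨i, hin⟩ => ?_
  have hi : i + 1 < n + 1 := by omega
  simp only [Fin.castSucc_mk, Fin.succ_mk, Fin.mk_lt_mk]
  rcases lt_or_ge i p with hip | hip
  · have hdown : (f ⟨i + 1, hi⟩ : ℕ) < f ⟨i, by omega⟩ := by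
      by_contra hcon
      have := htie i hi
      have := hup i hi (by omega) (p - 1) (by omega) (by omega)
      simp only [show p - 1 + 1 = p by omega] at this
      omega
    split_ifs <;> omega
  · have h0 : (f ⟨p, hpn⟩ : ℕ) < f ⟨p + 1, by omega⟩ := by
      have := htie p (by omega)
      omega
    have := hup p (by omega) h0 i hip hi
    split_ifs <;> omega

lemma peakSet_natAbs {n : ℕ} {t : Fin n → ℤ} (ht : StrictMono t) {f : Fin n → Fin n}
    (hf : ∀ i, (f i : ℕ) = (t i).natAbs) : peakSet f = ∅ := by
  rw [peakSet_eq_empty_iff]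
  intro i hi h1 h2
  rw [Fin.lt_def, hf, hf] at h1 h2
  have h3 : t ⟨i, by omega⟩ < t ⟨i + 1, by omega⟩ := ht (by simp)
  have h4 : t ⟨i + 1, by omega⟩ < t ⟨i + 2, by omega⟩ := ht (by simp)
  omega

lemma tieSet_natAbs {n : ℕ} {t : Fin n → ℤ} (ht : StrictMono t) {p : Fin n} (hp : t p = 0)
    {f : Fin n → Fin n} (hf : ∀ i, (f i : ℕ) = (t i).natAbs) : tieSet f = ∅ := by
  rw [tieSet_eq_empty_iff]
  intro i hi h
  rw [Fin.ext_iff, hf, hf] at h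
  have h3 : t ⟨i, by omega⟩ < t ⟨i + 1, by omega⟩ := ht (by simp)
  rcases le_or_gt p ⟨i, by omega⟩ with hpi | hpi
  · have := ht.monotone hpi
    omega
  · have : t ⟨i + 1, by omega⟩ ≤ t p := ht.monotone (by rw [Fin.lt_def] at hpi; exact hpi)
    omega

lemma isSignedPF_natAbs_injective {n : ℕ} (hn : 1 ≤ n) {t u : Fin n → ℤ} (ht : IsSignedPF t)
    (hu : IsSignedPF u) (h : ∀ i, (t i).natAbs = (u i).natAbs) : t = u := by
  obtain ⟨p, hp⟩ := exists_eq_zero_of_count hn ht.2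
  have hp' := h p
  ext i
  have := h i
  rcases le_total i p with hi | hi
  · have h1 := ht.1.monotone hi
    have h2 := hu.1.monotone hi
    omega
  · have h1 := ht.1.monotone hi
    have h2 := hu.1.monotone hi
    omega

lemma card_peakless_tieless_isPF {n : ℕ} (hn : 1 ≤ n) :
    Nat.card {f : Fin n → Fin n // IsPF f ∧ peakSet f = ∅ ∧ tieSet f = ∅} =
      Nat.card {t : Fin n → ℤ // IsSignedPF t} := by
  symm
  refine Nat.card_eq_of_bijective (fun t : {t : Fin n → ℤ // IsSignedPF t} =>
    (⟨fun i => ⟨(t.1 i).natAbs, forall_lt_of_count t.2.2 i⟩, ?_, ?_, ?_⟩ :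
      {f : Fin n → Fin n // IsPF f ∧ peakSet f = ∅ ∧ tieSet f = ∅})) ⟨?_, ?_⟩
  · exact (isPF_iff _).2 t.2.2
  · exact peakSet_natAbs t.2.1 fun _ => rfl
  · obtain ⟨p, hp⟩ := exists_eq_zero_of_count hn t.2.2
    exact tieSet_natAbs t.2.1 (Int.natAbs_eq_zero.1 hp) fun _ => rfl
  · rintro ⟨t, ht⟩ ⟨u, hu⟩ h
    refine Subtype.ext (isSignedPF_natAbs_injective hn ht hu fun i => ?_)
    exact Fin.ext_iff.1 (congrFun (Subtype.ext_iff.1 h) i)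
  · rintro ⟨f, hf, hpeak, htie⟩
    rw [isPF_iff] at hf
    obtain ⟨p, hp⟩ := exists_eq_zero_of_count hn hf
    have habs (i : Fin n) :
        (if i < p then -((f i : ℕ) : ℤ) else (f i : ℕ)).natAbs = (f i : ℕ) := by
      split_ifs <;> simp
    refine ⟨⟨_, strictMono_signed hpeak htie hp, ?_⟩, ?_⟩
    · simpa only [habs] using hf
    · exact Subtype.ext (funext fun i => Fin.ext (habs i))

end

/-- The number of peakless-tieless parking functions of length `n` is the `n`-th
Catalan number. -/
theorem stmt8 (n : ℕ) (hn : 1 ≤ n) :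
    (Finset.univ.filter (fun f : Fin n → Fin n =>
        IsPF f ∧ peakSet f = ∅ ∧ tieSet f = ∅)).card = catalan n := by
  rw [← card_isBallotSet, ← card_isSignedPF hn, ← card_peakless_tieless_isPF hn,
    Nat.card_eq_fintype_card, Fintype.card_subtype]
end
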